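/- arXiv:2208.13013 — 2 statements merged into one kernel-verified Lean document; each statement's English description precedes it below -/
import Mathlib

section
/- Suppose $\bar M^2(L_0)>1$ (supersonic initial state) and the external force satisfies $\bar f(x)>0$ for all $x\in(L_0,L_1)$. Then the solution of the ODE $\frac{d}{dx}\bar M^2 = \frac{(\gamma+1)\bar M^2}{\bar M^2-1}\cdot\frac{\bar f}{c^2(\bar\rho)}$ remains supersonic ($\bar M^2(x)>1$) and exists globally on $[L_0,L_1]$; consequently the system $(\bar\rho\bar u)'=0$, $\bar\rho\bar u\bar u'+(\bar\rho^\gamma)'=\bar\rho\bar f$ with supersonic initial data $(\rho_0,u_0)$ at $x=L_0$ has a unique smooth supersonic solution on $[L_0,L_1]$. -/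
open Set

/-- A smooth supersonic solution of the 1-D steady isentropic Euler system with
external force `f` on `[L0, L1]` with initial data `(ρ0, u0)` at `x = L0`:
`(ρ u)' = 0`, `(ρ u² + ρ^γ)' = ρ f` (equivalent to `ρ u u' + (ρ^γ)' = ρ f`
given constant mass flux), with `u² > c²(ρ) = γ ρ^(γ-1)` throughout. -/
def IsSupersonicSol (L0 L1 γ ρ0 u0 : ℝ) (f ρ u : ℝ → ℝ) : Prop :=
  ContDiffOn ℝ (⊤ : ℕ∞) ρ (Icc L0 L1) ∧ ContDiffOn ℝ (⊤ : ℕ∞) u (Icc L0 L1) ∧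
  ρ L0 = ρ0 ∧ u L0 = u0 ∧
  (∀ x ∈ Icc L0 L1, 0 < ρ x ∧ 0 < u x ∧ γ * ρ x ^ (γ - 1) < (u x) ^ 2) ∧
  (∀ x ∈ Icc L0 L1, HasDerivWithinAt (fun t => ρ t * u t) 0 (Icc L0 L1) x) ∧
  (∀ x ∈ Icc L0 L1,
    HasDerivWithinAt (fun t => ρ t * (u t) ^ 2 + ρ t ^ γ) (ρ x * f x) (Icc L0 L1) x)

open scoped ContDiff Topology

/-- A right inverse of an injective `C^n` function with nonvanishing derivative, composed with a
`C^n` function, is `C^n`. -/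
theorem contDiffWithinAt_of_injOn_comp_eqOn {n : WithTop ℕ∞} (hn : n ≠ 0) {G E u : ℝ → ℝ}
    {S s : Set ℝ} {x G' : ℝ} (hx : x ∈ s) (hS : S ∈ 𝓝 (u x)) (hinj : InjOn G S)
    (hG : ContDiffAt ℝ n G (u x)) (hG' : HasDerivAt G G' (u x)) (hne : G' ≠ 0)
    (hE : ContDiffWithinAt ℝ n E s x) (hu : MapsTo u s S) (hGu : EqOn (G ∘ u) E s) :
    ContDiffWithinAt ℝ n u s x := by
  have hGx : G (u x) = E x := hGu hx
  have hG'' := hG'.hasFDerivAt_equiv hne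
  set g := hG.localInverse hG'' hn
  have hgC : ContDiffAt ℝ n g (E x) := hGx ▸ hG.to_localInverse hG'' hn
  have hgx : g (E x) = u x := hGx ▸ hG.localInverse_apply_image hG'' hn
  have hright : ∀ᶠ y in 𝓝 (E x), G (g y) = y :=
    hGx ▸ (hG.hasStrictFDerivAt' hG'' hn).eventually_right_inverse
  have hmem : ∀ᶠ y in 𝓝 (E x), g y ∈ S :=
    hgC.continuousAt.eventually (by rwa [hgx])
  refine (hgC.comp_contDiffWithinAt x hE).congr_of_eventuallyEq_of_mem ?_ hx
  filter_upwards [hE.continuousWithinAt.eventually hright,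
    hE.continuousWithinAt.eventually hmem, self_mem_nhdsWithin] with t h1 h2 ht
  exact hinj (hu ht) h2 ((hGu ht).trans h1.symm)

/-- The Bernoulli function `u² / 2 + γ / (γ - 1) ρ^(γ - 1)` at mass flux `J = ρ u`. -/
noncomputable def bernoulliEnergy (γ J v : ℝ) : ℝ :=
  v ^ 2 / 2 + γ / (γ - 1) * (J / v) ^ (γ - 1)

/-- The supersonic velocities at mass flux `J`. -/
def supersonicVelocities (γ J : ℝ) : Set ℝ :=
  {v | 0 < v ∧ γ * (J / v) ^ (γ - 1) < v ^ 2}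

section Bernoulli

variable {γ J v w : ℝ}

theorem supersonicVelocities_of_le (hγ : 1 < γ) (hJ : 0 < J) (hv : v ∈ supersonicVelocities γ J)
    (hvw : v ≤ w) : w ∈ supersonicVelocities γ J := by
  obtain ⟨hv0, hv⟩ := hv
  refine ⟨hv0.trans_le hvw, ?_⟩
  have h : (J / w) ^ (γ - 1) ≤ (J / v) ^ (γ - 1) := by
    have := hv0.trans_le hvw
    apply Real.rpow_le_rpow (by positivity) (by gcongr) (by linarith)
  calc γ * (J / w) ^ (γ - 1) ≤ γ * (J / v) ^ (γ - 1) := by gcongr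
    _ < v ^ 2 := hv
    _ ≤ w ^ 2 := by gcongr

theorem convex_supersonicVelocities (hγ : 1 < γ) (hJ : 0 < J) :
    Convex ℝ (supersonicVelocities γ J) :=
  OrdConnected.convex ⟨fun _ hx _ _ _ hz => supersonicVelocities_of_le hγ hJ hx hz.1⟩

theorem supersonicVelocities_mem_nhds (hJ : 0 < J) (hv : v ∈ supersonicVelocities γ J) :
    supersonicVelocities γ J ∈ 𝓝 v := by
  have hv0 : v ≠ 0 := hv.1.ne'
  have hq : J / v ≠ 0 := div_ne_zero hJ.ne' hv0
  have hc : ContinuousAt (fun w => γ * (J / w) ^ (γ - 1)) v :=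
    ((continuousAt_const.div continuousAt_id hv0).rpow_const (Or.inl hq)).const_mul γ
  filter_upwards [lt_mem_nhds hv.1,
    hc.eventually_lt (continuousAt_id.pow 2) hv.2] with w h1 h2
  exact ⟨h1, h2⟩

theorem hasDerivAt_bernoulliEnergy (hγ : 1 < γ) (hJ : 0 < J) (hv : 0 < v) :
    HasDerivAt (bernoulliEnergy γ J) ((v ^ 2 - γ * (J / v) ^ (γ - 1)) / v) v := by
  have hq : 0 < J / v := by positivity
  have h1 : HasDerivAt (fun w => J / w) (-J / v ^ 2) v := by
    simpa [neg_div] using (hasDerivAt_const v J).fun_div (hasDerivAt_id' v) hv.ne'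
  have h2 := ((hasDerivAt_pow 2 v).div_const 2).add
    ((h1.rpow_const (p := γ - 1) (Or.inl hq.ne')).const_mul (γ / (γ - 1)))
  refine h2.congr_deriv ?_
  rw [Real.rpow_sub_one hq.ne' (γ - 1)]
  have : γ - 1 ≠ 0 := by linarith
  field_simp
  ring

theorem strictMonoOn_bernoulliEnergy (hγ : 1 < γ) (hJ : 0 < J) :
    StrictMonoOn (bernoulliEnergy γ J) (supersonicVelocities γ J) := by
  refine strictMonoOn_of_deriv_pos (convex_supersonicVelocities hγ hJ)
    (fun v hv => (hasDerivAt_bernoulliEnergy hγ hJ hv.1).continuousAt.continuousWithinAt) fun v hv => ?_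
  have hv := interior_subset hv
  rw [(hasDerivAt_bernoulliEnergy hγ hJ hv.1).deriv]
  exact div_pos (sub_pos.2 hv.2) hv.1

theorem contDiffAt_bernoulliEnergy {n : WithTop ℕ∞} (hJ : 0 < J) (hv : 0 < v) :
    ContDiffAt ℝ n (bernoulliEnergy γ J) v := by
  have hq : J / v ≠ 0 := by positivity
  exact ((contDiffAt_id.pow 2).div_const 2).add
    (contDiffAt_const.mul ((contDiffAt_const.div contDiffAt_id hv.ne').rpow_const_of_ne hq))

theorem exists_bernoulliEnergy_eq (hγ : 1 < γ) (hJ : 0 < J) (hv : 0 < v) {y : ℝ}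
    (hy : bernoulliEnergy γ J v ≤ y) : ∃ w, v ≤ w ∧ bernoulliEnergy γ J w = y := by
  set V := v + |y| + 2
  have hvV : v ≤ V := by have := abs_nonneg y; linarith
  have hV0 : 0 < V := hv.trans_le hvV
  have hVy : y ≤ bernoulliEnergy γ J V := by
    have h1 : 0 ≤ γ / (γ - 1) * (J / V) ^ (γ - 1) := by
      have : 0 < γ - 1 := by linarith
      positivity
    have h2 : y ≤ V ^ 2 / 2 := by
      have := abs_nonneg y
      nlinarith [le_abs_self y]
    unfold bernoulliEnergy
    linarith
  obtain ⟨w, hw, hwy⟩ := intermediate_value_Icc hvV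
    (fun z hz => (hasDerivAt_bernoulliEnergy hγ hJ
      (hv.trans_le hz.1)).continuousAt.continuousWithinAt) ⟨hy, hVy⟩
  exact ⟨w, hw.1, hwy⟩

end Bernoulli

/-- Given conservation of mass, the momentum equation is equivalent to the energy equation. -/
theorem hasDerivWithinAt_momentum_iff_energy {s : Set ℝ} {x γ F : ℝ} {ρ u : ℝ → ℝ} (hγ : 1 < γ)
    (hs : UniqueDiffWithinAt ℝ s x) (hρ0 : 0 < ρ x)
    (hρ : DifferentiableWithinAt ℝ ρ s x) (hu : DifferentiableWithinAt ℝ u s x)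
    (hmass : HasDerivWithinAt (fun t => ρ t * u t) 0 s x) :
    HasDerivWithinAt (fun t => ρ t * u t ^ 2 + ρ t ^ γ) (ρ x * F) s x ↔
      HasDerivWithinAt (fun t => u t ^ 2 / 2 + γ / (γ - 1) * ρ t ^ (γ - 1)) F s x := by
  have hr := hρ.hasDerivWithinAt
  have hw := hu.hasDerivWithinAt
  set r := derivWithin ρ s x
  set w := derivWithin u s x
  have hmass0 : r * u x + ρ x * w = 0 := hs.eq_deriv _ (hr.mul hw) hmass
  have hγ' : γ - 1 ≠ 0 := by linarith
  have hen : HasDerivWithinAt (fun t => u t ^ 2 / 2 + γ / (γ - 1) * ρ t ^ (γ - 1))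
      (u x * w + γ * (ρ x ^ (γ - 1) / ρ x) * r) s x := by
    refine (((hw.pow 2).div_const 2).add
      ((hr.rpow_const (p := γ - 1) (Or.inl hρ0.ne')).const_mul (γ / (γ - 1)))).congr_deriv ?_
    rw [Real.rpow_sub_one hρ0.ne' (γ - 1)]
    field_simp
    ring
  have hmo : HasDerivWithinAt (fun t => ρ t * u t ^ 2 + ρ t ^ γ)
      (ρ x * (u x * w + γ * (ρ x ^ (γ - 1) / ρ x) * r)) s x := by
    refine ((hr.mul (hw.fun_pow 2)).add
      (hr.rpow_const (p := γ) (Or.inl hρ0.ne'))).congr_deriv ?_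
    field_simp
    push_cast
    linear_combination u x * hmass0
  constructor
  · intro h
    exact hen.congr_deriv (mul_left_cancel₀ hρ0.ne' (hs.eq_deriv _ hmo h))
  · intro h
    exact hmo.congr_deriv (by rw [hs.eq_deriv _ hen h])

theorem eq_left_of_hasDerivWithinAt_zero {a b : ℝ} {g : ℝ → ℝ}
    (hg : ∀ x ∈ Icc a b, HasDerivWithinAt g 0 (Icc a b) x) : ∀ x ∈ Icc a b, g x = g a :=
  constant_of_derivWithin_zero (fun x hx => (hg x hx).differentiableWithinAt) fun x hx =>
    (hg x (Ico_subset_Icc_self hx)).derivWithin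
      (uniqueDiffOn_Icc (hx.1.trans_lt hx.2) x (Ico_subset_Icc_self hx))

/-- A supersonic solution has constant mass flux, and its Bernoulli function is the initial one
plus the work of the force. -/
theorem IsSupersonicSol.conservation {L0 L1 γ ρ0 u0 : ℝ} {f ρ u E : ℝ → ℝ} (hL : L0 < L1)
    (hγ : 1 < γ) (h : IsSupersonicSol L0 L1 γ ρ0 u0 f ρ u) (hE : ∀ x, HasDerivAt E (f x) x)
    (hE0 : E L0 = bernoulliEnergy γ (ρ0 * u0) u0) :
    ∀ x ∈ Icc L0 L1, ρ x = ρ0 * u0 / u x ∧ u x ∈ supersonicVelocities γ (ρ0 * u0) ∧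
      bernoulliEnergy γ (ρ0 * u0) (u x) = E x := by
  obtain ⟨hρC, huC, hρi, hui, hpos, hmass, hmom⟩ := h
  have hL0 : L0 ∈ Icc L0 L1 := left_mem_Icc.2 hL.le
  have hdensity : ∀ x ∈ Icc L0 L1, ρ x = ρ0 * u0 / u x := fun x hx => by
    rw [eq_div_iff (hpos x hx).2.1.ne', ← hρi, ← hui]
    exact eq_left_of_hasDerivWithinAt_zero hmass x hx
  have hen : ∀ x ∈ Icc L0 L1,
      (u x ^ 2 / 2 + γ / (γ - 1) * ρ x ^ (γ - 1)) - E x =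
        (u L0 ^ 2 / 2 + γ / (γ - 1) * ρ L0 ^ (γ - 1)) - E L0 :=
    eq_left_of_hasDerivWithinAt_zero
      (g := fun t => (u t ^ 2 / 2 + γ / (γ - 1) * ρ t ^ (γ - 1)) - E t) fun x hx => by
        simpa using ((hasDerivWithinAt_momentum_iff_energy hγ (uniqueDiffOn_Icc hL x hx)
          (hpos x hx).1 (hρC.differentiableOn (by simp) x hx)
          (huC.differentiableOn (by simp) x hx) (hmass x hx)).1 (hmom x hx)).fun_sub
            (hE x).hasDerivWithinAt
  intro x hx
  refine ⟨hdensity x hx, ⟨(hpos x hx).2.1, hdensity x hx ▸ (hpos x hx).2.2⟩, ?_⟩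
  have h1 := hen x hx
  rw [hdensity x hx, hdensity L0 hL0, hE0, hui] at h1
  unfold bernoulliEnergy at h1 ⊢
  linarith

/-- if the initial state is supersonic and the external force is
positive on `(L0, L1)`, then the flow remains supersonic and exists globally on
`[L0, L1]`: the 1-D steady Euler system with force has a unique smooth
supersonic solution on `[L0, L1]`. -/
theorem stmt2 (L0 L1 γ ρ0 u0 : ℝ) (hL : L0 < L1) (hγ1 : 1 < γ) (hγ3 : γ < 3)
    (hρ0 : 0 < ρ0) (hu0 : 0 < u0) (hsup : γ * ρ0 ^ (γ - 1) < u0 ^ 2)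
    (f : ℝ → ℝ) (hfC : ContDiff ℝ (⊤ : ℕ∞) f) (hf : ∀ x ∈ Ioo L0 L1, 0 < f x) :
    ∃ ρ u : ℝ → ℝ, IsSupersonicSol L0 L1 γ ρ0 u0 f ρ u ∧
      ∀ ρ' u' : ℝ → ℝ, IsSupersonicSol L0 L1 γ ρ0 u0 f ρ' u' →
        EqOn ρ ρ' (Icc L0 L1) ∧ EqOn u u' (Icc L0 L1) := by
  have hJ : 0 < ρ0 * u0 := mul_pos hρ0 hu0
  have hu0S : u0 ∈ supersonicVelocities γ (ρ0 * u0) :=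
    ⟨hu0, by rwa [mul_div_cancel_right₀ _ hu0.ne']⟩
  obtain ⟨E, hE, hE0⟩ : ∃ E : ℝ → ℝ, (∀ x, HasDerivAt E (f x) x) ∧
      E L0 = bernoulliEnergy γ (ρ0 * u0) u0 := by
    refine ⟨fun x => bernoulliEnergy γ (ρ0 * u0) u0 + ∫ t in L0..x, f t, fun x => ?_, by simp⟩
    exact (hfC.continuous.integral_hasStrictDerivAt L0 x).hasDerivAt.const_add _
  have hEd : Differentiable ℝ E := fun x => (hE x).differentiableAt
  have hEC : ContDiff ℝ ∞ E :=
    contDiff_infty_iff_deriv.2 ⟨hEd, by rwa [funext fun x => (hE x).deriv]⟩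
  have hEge : ∀ x ∈ Icc L0 L1, bernoulliEnergy γ (ρ0 * u0) u0 ≤ E x := fun x hx => by
    rw [← hE0]
    refine monotoneOn_of_deriv_nonneg (convex_Icc L0 L1) hEd.continuous.continuousOn
      hEd.differentiableOn (fun y hy => ?_) (left_mem_Icc.2 hL.le) hx hx.1
    rw [interior_Icc] at hy
    rw [(hE y).deriv]
    exact (hf y hy).le
  choose! u hu0u hGu using fun x hx => exists_bernoulliEnergy_eq hγ1 hJ hu0 (hEge x hx)
  have huS : ∀ x ∈ Icc L0 L1, u x ∈ supersonicVelocities γ (ρ0 * u0) := fun x hx =>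
    supersonicVelocities_of_le hγ1 hJ hu0S (hu0u x hx)
  have hinj := (strictMonoOn_bernoulliEnergy hγ1 hJ).injOn
  have huC : ContDiffOn ℝ ∞ u (Icc L0 L1) := fun x hx =>
    contDiffWithinAt_of_injOn_comp_eqOn (by simp) hx
      (supersonicVelocities_mem_nhds hJ (huS x hx)) hinj (contDiffAt_bernoulliEnergy hJ (huS x hx).1)
      (hasDerivAt_bernoulliEnergy hγ1 hJ (huS x hx).1)
      (div_pos (sub_pos.2 (huS x hx).2) (huS x hx).1).ne' hEC.contDiffAt.contDiffWithinAt huS hGu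
  have hρC : ContDiffOn ℝ ∞ (fun x => ρ0 * u0 / u x) (Icc L0 L1) :=
    contDiffOn_const.div huC fun x hx => (huS x hx).1.ne'
  have hpos : ∀ x ∈ Icc L0 L1, 0 < ρ0 * u0 / u x := fun x hx => div_pos hJ (huS x hx).1
  have hL0 : L0 ∈ Icc L0 L1 := left_mem_Icc.2 hL.le
  have hui : u L0 = u0 := hinj (huS L0 hL0) hu0S ((hGu L0 hL0).trans hE0)
  have hmass : ∀ x ∈ Icc L0 L1,
      HasDerivWithinAt (fun t => ρ0 * u0 / u t * u t) 0 (Icc L0 L1) x := fun x hx =>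
    (hasDerivWithinAt_const x _ (ρ0 * u0)).congr_of_mem
      (fun t ht => div_mul_cancel₀ _ (huS t ht).1.ne') hx
  refine ⟨fun x => ρ0 * u0 / u x, u, ⟨hρC, huC, ?_, hui, fun x hx => ?_, hmass, fun x hx => ?_⟩,
    fun ρ' u' h' => ?_⟩
  · simp only [hui, mul_div_cancel_right₀ _ hu0.ne']
  · exact ⟨hpos x hx, huS x hx⟩
  · refine (hasDerivWithinAt_momentum_iff_energy hγ1 (uniqueDiffOn_Icc hL x hx)
      (hpos x hx) (hρC.differentiableOn (by simp) x hx)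
      (huC.differentiableOn (by simp) x hx) (hmass x hx)).2 ?_
    exact (hE x).hasDerivWithinAt.congr_of_mem hGu hx
  · have hcons := h'.conservation hL hγ1 hE hE0
    have heq : EqOn u u' (Icc L0 L1) := fun x hx =>
      hinj (huS x hx) (hcons x hx).2.1 ((hGu x hx).trans (hcons x hx).2.2.symm)
    exact ⟨fun x hx => by simp only [(hcons x hx).1, heq hx], heq⟩
end

section
/- For the characteristic ODE $\frac{dy_2}{ds}(s;\beta) = \frac{\hat v_2\,(L_1-\hat v_4 - L_s)}{(\bar u+\hat v_1)(L_1-L_s) + \hat v_2\,(s-L_1)\hat v_4'(y_2)}$, $y_2(L_s)=\beta$, on $s\in[L_s,L_1]$: if $\bar u\ge c_0>0$, the perturbations satisfy $\|\hat v_1\|_{C^0},\|\hat v_2\|_{C^0},\|\hat v_4\|_{C^1}\le\delta$ with $\delta$ small enough, and $\hat v_2(y_1,\pm1)=0$, then for each $\beta\in[-1,1]$ a unique solution exists on all of $[L_s,L_1]$, remains in $[-1,1]$, and the characteristics through $\beta=\pm1$ are the constant lines $y_2\equiv\pm1$ (i.e., the boundary is invariant). -/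
open Set Filter Topology

/-- The characteristic field written through the slope `w = v₂ / (ū + v₁)`. -/
noncomputable def slopeField (a b : ℝ) (w : ℝ × ℝ → ℝ) (h : ℝ → ℝ) (s z : ℝ) : ℝ :=
  w (s, z) * (b - a - h z) / ((b - a) - w (s, z) * (b - s) * deriv h z)

/-- Quantitative smallness of the slope `w` and of the boundary perturbation `h`. -/
structure SmallSlope (a b : ℝ) (w : ℝ × ℝ → ℝ) (h : ℝ → ℝ) : Prop where
  lt : a < b
  contDiffAt_slope : ∀ p ∈ Icc a b ×ˢ Icc (-1 : ℝ) 1, ContDiffAt ℝ 1 w p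
  abs_slope_le : ∀ p ∈ Icc a b ×ˢ Icc (-1 : ℝ) 1, |w p| ≤ 1 / 3
  contDiff_boundary : ContDiff ℝ 1 h
  abs_boundary_le : ∀ t ∈ Icc (-1 : ℝ) 1, |h t| ≤ (b - a) / 4
  abs_deriv_boundary_le : ∀ t ∈ Icc (-1 : ℝ) 1, |deriv h t| ≤ 1 / 4
  slope_one : ∀ s ∈ Icc a b, w (s, 1) = 0
  slope_neg_one : ∀ s ∈ Icc a b, w (s, -1) = 0

theorem abs_clamp_sub_clamp_le (p q x y : ℝ) :
    |max p (min q x) - max p (min q y)| ≤ |x - y| := by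
  have h₁ := abs_max_sub_max_le_abs (min q x) (min q y) p
  have h₂ := abs_min_sub_min_le_max q x q y
  rw [max_comm p, max_comm p]
  refine h₁.trans (h₂.trans ?_)
  simp

theorem clamp_mem_Icc {p q : ℝ} (hpq : p ≤ q) (x : ℝ) : max p (min q x) ∈ Icc p q :=
  ⟨le_max_left _ _, max_le hpq (min_le_left _ _)⟩

theorem clamp_eq_self {p q x : ℝ} (hx : x ∈ Icc p q) : max p (min q x) = x := by
  rw [min_eq_right hx.2, max_eq_right hx.1]

/-- A function with positive derivative on `[p, q]` has a differentiable inverse. -/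
theorem exists_inverse_hasDerivWithinAt {S S' : ℝ → ℝ} {p q : ℝ} (hpq : p ≤ q)
    (hS : ∀ x ∈ Icc p q, HasDerivWithinAt S (S' x) (Icc p q) x)
    (hpos : ∀ x ∈ Icc p q, 0 < S' x) :
    StrictMonoOn S (Icc p q) ∧ ∃ T : ℝ → ℝ, ∀ s ∈ Icc (S p) (S q), T s ∈ Icc p q ∧ S (T s) = s ∧
      HasDerivWithinAt T (S' (T s))⁻¹ (Icc (S p) (S q)) s := by
  have hcont : ContinuousOn S (Icc p q) := fun x hx => (hS x hx).continuousWithinAt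
  have hmono : StrictMonoOn S (Icc p q) := by
    refine strictMonoOn_of_hasDerivWithinAt_pos (convex_Icc p q) hcont (f' := S')
      (fun x hx => (hS x (interior_subset hx)).mono interior_subset)
      (fun x hx => hpos x (interior_subset hx))
  refine ⟨hmono, ?_⟩
  have himage : S '' Icc p q = Icc (S p) (S q) := by
    apply Subset.antisymm
    · rintro _ ⟨x, hx, rfl⟩
      exact ⟨hmono.monotoneOn (left_mem_Icc.2 hpq) hx hx.1,
        hmono.monotoneOn hx (right_mem_Icc.2 hpq) hx.2⟩
    · exact intermediate_value_Icc hpq hcont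
  have hconn : OrdConnected (S '' Icc p q) := himage ▸ ordConnected_Icc
  let e := hmono.orderIso S (Icc p q)
  have hle : S p ≤ S q := hmono.monotoneOn (left_mem_Icc.2 hpq) (right_mem_Icc.2 hpq) hpq
  have hcl (s : ℝ) : max (S p) (min (S q) s) ∈ S '' Icc p q := himage ▸ clamp_mem_Icc hle s
  let T : ℝ → ℝ := fun s => e.symm ⟨max (S p) (min (S q) s), hcl s⟩
  have hTcont : Continuous T := by
    refine continuous_subtype_val.comp (e.symm.continuous.comp ?_)
    exact Continuous.subtype_mk (by fun_prop) _
  have hTmem (s : ℝ) : T s ∈ Icc p q := (e.symm _).2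
  have hST : ∀ s ∈ Icc (S p) (S q), S (T s) = s := by
    intro s hs
    have := congrArg Subtype.val (e.apply_symm_apply ⟨max (S p) (min (S q) s), hcl s⟩)
    exact this.trans (clamp_eq_self hs)
  refine ⟨T, fun s hs => ⟨hTmem s, hST s hs, ?_⟩⟩
  have hne : S' (T s) ≠ 0 := (hpos _ (hTmem s)).ne'
  have hlim : Tendsto T (𝓝[Icc (S p) (S q)] s) (𝓝[Icc p q] (T s)) :=
    tendsto_nhdsWithin_iff.2 ⟨hTcont.continuousWithinAt, Eventually.of_forall hTmem⟩
  have hT := (hS (T s) (hTmem s)).hasFDerivWithinAt.of_comp_of_leftInverse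
    (f'symm := .toSpanSingleton ℝ (S' (T s))⁻¹) hlim (hasFDerivWithinAt_id s _)
    (eventually_nhdsWithin_of_forall hST) (fun _ => by simp [hne]) hs
  simpa using hT.hasDerivWithinAt

/-- A solution of a scalar ODE cannot cross upwards a level above which the field is nonpositive. -/
theorem le_of_field_nonpos_above {f : ℝ → ℝ → ℝ} {Y : ℝ → ℝ} {p q c : ℝ}
    (hY : ∀ x ∈ Icc p q, HasDerivWithinAt Y (f x (Y x)) (Icc p q) x) (hp : Y p ≤ c)
    (hf : ∀ x ∈ Icc p q, ∀ y, c ≤ y → f x y ≤ 0) : ∀ x ∈ Icc p q, Y x ≤ c := by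
  intro x hx
  have key : ∀ ε > 0, Y x ≤ c + ε * (x - p) := by
    intro ε hε
    refine image_le_of_deriv_right_lt_deriv_boundary' (f := Y) (f' := fun x => f x (Y x))
      (B := fun x => c + ε * (x - p)) (B' := fun _ => ε)
      (fun x hx => (hY x hx).continuousWithinAt) ?_ (by simpa using hp) (by fun_prop) ?_ ?_ hx
    · exact fun t ht => (hY t (Ico_subset_Icc_self ht)).mono_of_mem_nhdsWithin
        (Icc_mem_nhdsGE_of_mem ht)
    · intro t _
      simpa using ((((hasDerivAt_id t).sub_const p).const_mul ε).const_add c).hasDerivWithinAt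
    · intro t ht heq
      refine (hf t (Ico_subset_Icc_self ht) _ ?_).trans_lt hε
      rw [heq]
      nlinarith [ht.1]
  refine le_of_forall_pos_le_add fun η hη => ?_
  have hd : 0 < x - p + 1 := by linarith [hx.1]
  refine (key (η / (x - p + 1)) (by positivity)).trans ?_
  have : η / (x - p + 1) * (x - p) ≤ η / (x - p + 1) * (x - p + 1) := by
    gcongr; linarith
  rw [div_mul_cancel₀ _ hd.ne'] at this
  linarith

namespace SmallSlope

variable {a b : ℝ} {w : ℝ × ℝ → ℝ} {h : ℝ → ℝ}

theorem exists_fderiv_bound (D : SmallSlope a b w h) :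
    ∃ M : ℝ, 0 ≤ M ∧ (∀ p ∈ Icc a b ×ˢ Icc (-1 : ℝ) 1, ‖fderiv ℝ w p‖ ≤ M) ∧
      ∀ p ∈ Icc a b ×ˢ Icc (-1 : ℝ) 1, ∀ q ∈ Icc a b ×ˢ Icc (-1 : ℝ) 1,
        |w p - w q| ≤ M * ‖p - q‖ := by
  have hc : ContinuousOn (fderiv ℝ w) (Icc a b ×ˢ Icc (-1 : ℝ) 1) := fun p hp =>
    ((D.contDiffAt_slope p hp).fderiv_right (m := 0) (by simp)).continuousAt.continuousWithinAt
  obtain ⟨M, hM⟩ := (isCompact_Icc.prod isCompact_Icc).exists_bound_of_continuousOn hc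
  have hM' : ∀ p ∈ Icc a b ×ˢ Icc (-1 : ℝ) 1, ‖fderiv ℝ w p‖ ≤ max M 0 :=
    fun p hp => (hM p hp).trans (le_max_left _ _)
  refine ⟨max M 0, le_max_right _ _, hM', fun p hp q hq => ?_⟩
  exact ((convex_Icc a b).prod (convex_Icc (-1 : ℝ) 1)).norm_image_sub_le_of_norm_fderiv_le
    (fun x hx => (D.contDiffAt_slope x hx).differentiableAt (by simp)) hM' hq hp

theorem abs_boundary_sub_le (D : SmallSlope a b w h) {y z : ℝ} (hy : y ∈ Icc (-1 : ℝ) 1)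
    (hz : z ∈ Icc (-1 : ℝ) 1) : |h y - h z| ≤ 1 / 4 * |y - z| :=
  (convex_Icc (-1 : ℝ) 1).norm_image_sub_le_of_norm_deriv_le
    (fun _ _ => D.contDiff_boundary.differentiable (by simp) _) D.abs_deriv_boundary_le hz hy

theorem hasDerivAt_boundary (D : SmallSlope a b w h) (t : ℝ) : HasDerivAt h (deriv h t) t :=
  (D.contDiff_boundary.differentiable (by simp) t).hasDerivAt

theorem abs_slope_mul_deriv_le (D : SmallSlope a b w h) {s z : ℝ} (hs : s ∈ Icc a b)
    (hz : z ∈ Icc (-1 : ℝ) 1) : |w (s, z) * (b - s) * deriv h z| ≤ (b - a) / 12 := by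
  have h₁ := D.abs_slope_le (s, z) ⟨hs, hz⟩
  have h₂ := D.abs_deriv_boundary_le z hz
  have h₃ : |b - s| ≤ b - a := by rw [abs_of_nonneg] <;> linarith [hs.1, hs.2]
  rw [abs_mul, abs_mul]
  calc |w (s, z)| * |b - s| * |deriv h z| ≤ 1 / 3 * (b - a) * (1 / 4) := by
        have := sub_pos.2 D.lt
        gcongr
    _ = (b - a) / 12 := by ring

theorem denom_pos (D : SmallSlope a b w h) {s z : ℝ} (hs : s ∈ Icc a b)
    (hz : z ∈ Icc (-1 : ℝ) 1) : 0 < (b - a) - w (s, z) * (b - s) * deriv h z := by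
  have := abs_le.1 (D.abs_slope_mul_deriv_le hs hz)
  linarith [D.lt]

theorem abs_slopeField_le (D : SmallSlope a b w h) {s z : ℝ} (hs : s ∈ Icc a b)
    (hz : z ∈ Icc (-1 : ℝ) 1) : |slopeField a b w h s z| ≤ 1 := by
  have h₁ := D.abs_slope_le (s, z) ⟨hs, hz⟩
  have h₂ := abs_le.1 (D.abs_slope_mul_deriv_le hs hz)
  have h₃ := abs_le.1 (D.abs_boundary_le z hz)
  have hpos := D.denom_pos hs hz
  have hlt := D.lt
  rw [slopeField, abs_div, abs_of_pos hpos, div_le_one hpos, abs_mul,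
    abs_of_nonneg (a := b - a - h z) (by linarith)]
  have : |w (s, z)| * (b - a - h z) ≤ 1 / 3 * (5 / 4 * (b - a)) := by
    gcongr
    · linarith
    · linarith
  linarith

/-- The slope equation `y' = w · d/ds (s + h (y) (b - s) / (b - a))`. -/
theorem slopeField_eq (D : SmallSlope a b w h) {s z : ℝ} (hs : s ∈ Icc a b)
    (hz : z ∈ Icc (-1 : ℝ) 1) :
    slopeField a b w h s z = w (s, z) * (1 - h z / (b - a) +
      deriv h z * slopeField a b w h s z * (b - s) / (b - a)) := by
  have hpos := (D.denom_pos hs hz).ne'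
  have hL : b - a ≠ 0 := (sub_pos.2 D.lt).ne'
  have key : slopeField a b w h s z * ((b - a) - w (s, z) * (b - s) * deriv h z) =
      w (s, z) * (b - a - h z) := div_mul_cancel₀ _ hpos
  field_simp
  linear_combination key

/-- Solutions are unique although the field is merely continuous: the corrected difference
`y - z - w (s, y) (h y - h z) (b - s) / (b - a)` has a derivative free of `deriv h (y s)`. -/
theorem eqOn_of_solution (D : SmallSlope a b w h) {y z : ℝ → ℝ}
    (hy : ∀ s ∈ Icc a b, HasDerivWithinAt y (slopeField a b w h s (y s)) (Icc a b) s)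
    (hz : ∀ s ∈ Icc a b, HasDerivWithinAt z (slopeField a b w h s (z s)) (Icc a b) s)
    (hym : ∀ s ∈ Icc a b, y s ∈ Icc (-1 : ℝ) 1) (hzm : ∀ s ∈ Icc a b, z s ∈ Icc (-1 : ℝ) 1)
    (h0 : y a = z a) : EqOn y z (Icc a b) := by
  obtain ⟨M, hM0, hM, hlip⟩ := D.exists_fderiv_bound
  have hlt := sub_pos.2 D.lt
  set L := b - a with hL
  let p : ℝ → ℝ := fun s => fderiv ℝ w (s, y s) (1, slopeField a b w h s (y s))
  let E : ℝ → ℝ := fun s => y s - z s - w (s, y s) * ((h (y s) - h (z s)) * ((b - s) / L))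
  let E' : ℝ → ℝ := fun s => (w (s, y s) - w (s, z s)) * (1 - h (z s) / L +
    deriv h (z s) * slopeField a b w h s (z s) * (b - s) / L) -
    p s * ((h (y s) - h (z s)) * ((b - s) / L))
  have hE : ∀ s ∈ Icc a b, HasDerivWithinAt E (E' s) (Icc a b) s := by
    intro s hs
    have hw : HasDerivWithinAt (fun s => w (s, y s)) (p s) (Icc a b) s :=
      ((D.contDiffAt_slope (s, y s) ⟨hs, hym s hs⟩).differentiableAt
        (by simp)).hasFDerivAt.comp_hasDerivWithinAt s
        ((hasDerivWithinAt_id s _).prodMk (hy s hs))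
    have h₁ := (D.hasDerivAt_boundary (y s)).comp_hasDerivWithinAt s (hy s hs)
    have h₂ := (D.hasDerivAt_boundary (z s)).comp_hasDerivWithinAt s (hz s hs)
    have h₃ : HasDerivWithinAt (fun s => (b - s) / L) (-1 / L) (Icc a b) s :=
      (((hasDerivAt_id s).const_sub b).div_const L).hasDerivWithinAt
    have := ((hy s hs).sub (hz s hs)).sub (hw.mul ((h₁.sub h₂).mul h₃))
    refine this.congr_deriv ?_
    have e₁ := D.slopeField_eq hs (hym s hs)
    have e₂ := D.slopeField_eq hs (hzm s hs)
    simp only [E', Function.comp_apply, Pi.sub_apply, Pi.mul_apply]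
    rw [← hL] at e₁ e₂
    linear_combination e₁ - e₂
  have habs : ∀ s ∈ Icc a b, |(h (y s) - h (z s)) * ((b - s) / L)| ≤ 1 / 4 * |y s - z s| := by
    intro s hs
    have h₁ := D.abs_boundary_sub_le (hym s hs) (hzm s hs)
    have h₂ : |(b - s) / L| ≤ 1 := by
      rw [abs_of_nonneg (div_nonneg (by linarith [hs.2]) hlt.le), div_le_one hlt]
      linarith [hs.1]
    rw [abs_mul]
    calc _ ≤ 1 / 4 * |y s - z s| * 1 := by gcongr
      _ = _ := mul_one _
  have hEe : ∀ s ∈ Icc a b, |y s - z s| ≤ 2 * |E s| := by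
    intro s hs
    have h₁ := D.abs_slope_le (s, y s) ⟨hs, hym s hs⟩
    have h₂ : |w (s, y s) * ((h (y s) - h (z s)) * ((b - s) / L))| ≤
        1 / 3 * (1 / 4 * |y s - z s|) := by
      rw [abs_mul]
      exact mul_le_mul h₁ (habs s hs) (abs_nonneg _) (by norm_num)
    have h₃ := abs_sub_abs_le_abs_sub (y s - z s)
      (w (s, y s) * ((h (y s) - h (z s)) * ((b - s) / L)))
    have h₄ := abs_nonneg (y s - z s)
    simp only [E]
    linarith
  have hbound : ∀ s ∈ Icc a b, |E' s| ≤ 6 * M * |E s| := by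
    intro s hs
    have hYm : (s, y s) ∈ Icc a b ×ˢ Icc (-1 : ℝ) 1 := ⟨hs, hym s hs⟩
    have hZm : (s, z s) ∈ Icc a b ×ˢ Icc (-1 : ℝ) 1 := ⟨hs, hzm s hs⟩
    have h₁ : |w (s, y s) - w (s, z s)| ≤ M * |y s - z s| := by
      simpa [Prod.norm_def] using hlip _ hYm _ hZm
    have h₂ : |1 - h (z s) / L + deriv h (z s) * slopeField a b w h s (z s) * (b - s) / L| ≤ 2 := by
      have i₁ : |h (z s) / L| ≤ 1 / 4 := by
        rw [abs_div, abs_of_pos hlt, div_le_iff₀ hlt]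
        linarith [D.abs_boundary_le _ (hzm s hs)]
      have i₂ : |deriv h (z s) * slopeField a b w h s (z s) * (b - s) / L| ≤ 1 / 4 := by
        rw [abs_div, abs_of_pos hlt, div_le_iff₀ hlt, abs_mul, abs_mul]
        have i₃ : |b - s| ≤ L := by rw [abs_of_nonneg] <;> linarith [hs.1, hs.2]
        calc _ ≤ 1 / 4 * 1 * L := by
              gcongr
              · exact D.abs_deriv_boundary_le _ (hzm s hs)
              · exact D.abs_slopeField_le hs (hzm s hs)
          _ = _ := by ring
      rw [abs_le] at *
      constructor <;> linarith
    have h₃ : |p s| ≤ M := by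
      refine ((fderiv ℝ w (s, y s)).le_opNorm _).trans ?_
      have : ‖((1 : ℝ), slopeField a b w h s (y s))‖ ≤ 1 := by
        simpa [Prod.norm_def] using D.abs_slopeField_le hs (hym s hs)
      calc _ ≤ M * 1 := by
            gcongr
            exact hM _ hYm
        _ = M := mul_one _
    have h₄ : |E' s| ≤ M * |y s - z s| * 2 + M * (1 / 4 * |y s - z s|) := by
      refine (abs_sub _ _).trans (add_le_add ?_ ?_)
      · rw [abs_mul]; gcongr
      · rw [abs_mul]; exact mul_le_mul h₃ (habs s hs) (abs_nonneg _) hM0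
    have h₅ := mul_le_mul_of_nonneg_left (hEe s hs) hM0
    have h₆ := mul_nonneg hM0 (abs_nonneg (y s - z s))
    nlinarith
  have hzero := eq_zero_of_abs_deriv_le_mul_abs_self_of_eq_zero_right (f := E) (f' := E')
    (fun s hs => (hE s hs).continuousWithinAt)
    (fun s hs => (hE s (Ico_subset_Icc_self hs)).mono_of_mem_nhdsWithin
      (Icc_mem_nhdsGE_of_mem hs))
    (by simp [E, h0]) (fun s hs => hbound s (Ico_subset_Icc_self hs))
  intro s hs
  have := hEe s hs
  rw [hzero s hs, abs_zero, mul_zero] at this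
  exact sub_eq_zero.1 (abs_nonpos_iff.1 this)

/-- The reference abscissa of the physical point `(x, y)`. -/
noncomputable def abscissa (a b : ℝ) (h : ℝ → ℝ) (x y : ℝ) : ℝ :=
  b - (b - x) * (b - a) / (b - a - h y)

theorem abs_abscissa_sub_le (D : SmallSlope a b w h) {x y z : ℝ}
    (hx : x ∈ Icc (a - (b - a) / 4) b) (hy : y ∈ Icc (-1 : ℝ) 1) (hz : z ∈ Icc (-1 : ℝ) 1) :
    |abscissa a b h x y - abscissa a b h x z| ≤ |y - z| := by
  have hlt := sub_pos.2 D.lt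
  have hy' := abs_le.1 (D.abs_boundary_le y hy)
  have hz' := abs_le.1 (D.abs_boundary_le z hz)
  have hd := D.abs_boundary_sub_le hy hz
  have p₁ : 3 / 4 * (b - a) ≤ b - a - h y := by linarith
  have p₂ : 3 / 4 * (b - a) ≤ b - a - h z := by linarith
  have q₁ : 0 < b - a - h y := by linarith
  have q₂ : 0 < b - a - h z := by linarith
  have e : abscissa a b h x y - abscissa a b h x z =
      (b - x) * (b - a) * (h z - h y) / ((b - a - h y) * (b - a - h z)) := by
    unfold abscissa
    field_simp
    ring
  rw [e, abs_div, abs_of_pos (mul_pos q₁ q₂), div_le_iff₀ (mul_pos q₁ q₂), abs_mul, abs_mul,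
    abs_of_pos hlt, abs_of_nonneg (a := b - x) (by linarith [hx.2]), abs_sub_comm (h z)]
  have hxb : b - x ≤ 5 / 4 * (b - a) := by linarith [hx.1]
  have m₁ : (3 / 4 * (b - a)) * (3 / 4 * (b - a)) ≤ (b - a - h y) * (b - a - h z) := by gcongr
  calc (b - x) * (b - a) * |h y - h z|
      ≤ (5 / 4 * (b - a)) * (b - a) * (1 / 4 * |y - z|) := by gcongr
    _ ≤ |y - z| * ((3 / 4 * (b - a)) * (3 / 4 * (b - a))) := by
        have := mul_nonneg (abs_nonneg (y - z)) (mul_pos hlt hlt).le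
        nlinarith
    _ ≤ |y - z| * ((b - a - h y) * (b - a - h z)) := by gcongr

/-- The physical streamline through `(a + h β, β)`. -/
theorem exists_streamline (D : SmallSlope a b w h) {β : ℝ} (hβ : β ∈ Icc (-1 : ℝ) 1) :
    ∃ Y : ℝ → ℝ, Y (a + h β) = β ∧ ∀ x ∈ Icc (a + h β) b, Y x ∈ Icc (-1 : ℝ) 1 ∧
      HasDerivWithinAt Y (w (max a (min b (abscissa a b h x (Y x))), Y x))
        (Icc (a + h β) b) x := by
  obtain ⟨M, hM0, -, hlip⟩ := D.exists_fderiv_bound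
  have hlt := sub_pos.2 D.lt
  have hβ' := abs_le.1 (D.abs_boundary_le β hβ)
  have hx₀ : a + h β ≤ b := by linarith
  have hc (y : ℝ) : max (-1) (min 1 y) ∈ Icc (-1 : ℝ) 1 := clamp_mem_Icc (by norm_num) y
  let f : ℝ → ℝ → ℝ := fun x y =>
    w (max a (min b (abscissa a b h x (max (-1) (min 1 y)))), max (-1) (min 1 y))
  have hmem (x y : ℝ) : (max a (min b (abscissa a b h x (max (-1) (min 1 y)))),
      max (-1) (min 1 y)) ∈ Icc a b ×ˢ Icc (-1 : ℝ) 1 := ⟨clamp_mem_Icc D.lt.le _, hc y⟩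
  have hPL : IsPicardLindelof f (⟨a + h β, left_mem_Icc.2 hx₀⟩ : Icc (a + h β) b) β
      (b - (a + h β)).toNNReal 0 1 M.toNNReal := by
    refine ⟨fun x hx => ?_, fun y _ => ?_, fun x _ y _ => ?_, ?_⟩
    · refine LipschitzOnWith.of_dist_le_mul fun y _ z _ => ?_
      rw [Real.coe_toNNReal _ hM0, Real.dist_eq, Real.dist_eq]
      refine (hlip _ (hmem x y) _ (hmem x z)).trans ?_
      gcongr
      have hx' : x ∈ Icc (a - (b - a) / 4) b := ⟨by linarith [hx.1], hx.2⟩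
      refine max_le ?_ (abs_clamp_sub_clamp_le _ _ _ _)
      exact (abs_clamp_sub_clamp_le _ _ _ _).trans
        ((D.abs_abscissa_sub_le hx' (hc y) (hc z)).trans (abs_clamp_sub_clamp_le _ _ _ _))
    · have hw : ContinuousOn w (Icc a b ×ˢ Icc (-1 : ℝ) 1) := fun p hp =>
        (D.contDiffAt_slope p hp).continuousAt.continuousWithinAt
      refine hw.comp (Continuous.continuousOn ?_) (fun x _ => hmem x y)
      unfold abscissa
      fun_prop
    · exact (D.abs_slope_le _ (hmem x y)).trans (by norm_num)
    · simp [hx₀]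
  obtain ⟨Y, hY₀, hY⟩ := hPL.exists_eq_forall_mem_Icc_hasDerivWithinAt₀
  simp only at hY₀
  have hle : ∀ x ∈ Icc (a + h β) b, Y x ≤ 1 := by
    refine le_of_field_nonpos_above hY (by rw [hY₀]; exact hβ.2) fun x _ y hy => ?_
    have : max (-1) (min 1 y) = 1 := by rw [min_eq_left hy]; norm_num
    simp only [f, this]
    exact (D.slope_one _ (clamp_mem_Icc D.lt.le _)).le
  have hge : ∀ x ∈ Icc (a + h β) b, -Y x ≤ 1 := by
    refine le_of_field_nonpos_above (f := fun x y => -f x (-y)) (Y := fun x => -Y x)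
      (fun x hx => (hY x hx).neg.congr_deriv (by simp only [neg_neg]))
      (by rw [hY₀]; linarith [hβ.1]) fun x _ y hy => ?_
    have : max (-1) (min 1 (-y)) = -1 := by
      rw [min_eq_right (by linarith), max_eq_left (by linarith)]
    simp only [f, this]
    rw [D.slope_neg_one _ (clamp_mem_Icc D.lt.le _), neg_zero]
  refine ⟨Y, hY₀, fun x hx => ?_⟩
  have hYm : Y x ∈ Icc (-1 : ℝ) 1 := ⟨by linarith [hge x hx], hle x hx⟩
  refine ⟨hYm, ?_⟩
  have := hY x hx
  simpa only [f, clamp_eq_self hYm] using this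

/-- Existence: reparametrize the physical streamline by its reference abscissa. -/
theorem exists_solution (D : SmallSlope a b w h) {β : ℝ} (hβ : β ∈ Icc (-1 : ℝ) 1) :
    ∃ y : ℝ → ℝ, y a = β ∧ ∀ s ∈ Icc a b, y s ∈ Icc (-1 : ℝ) 1 ∧
      HasDerivWithinAt y (slopeField a b w h s (y s)) (Icc a b) s := by
  obtain ⟨Y, hY₀, hY⟩ := D.exists_streamline hβ
  have hlt := sub_pos.2 D.lt
  have hβ' := abs_le.1 (D.abs_boundary_le β hβ)
  have hx₀ : a + h β ≤ b := by linarith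
  let S : ℝ → ℝ := fun x => abscissa a b h x (Y x)
  let g : ℝ → ℝ := fun x => w (max a (min b (S x)), Y x)
  let S' : ℝ → ℝ := fun x => (b - a) * (b - a - h (Y x) - (b - x) * (deriv h (Y x) * g x)) /
    (b - a - h (Y x)) ^ 2
  have hden : ∀ x ∈ Icc (a + h β) b, 3 / 4 * (b - a) ≤ b - a - h (Y x) := by
    intro x hx
    linarith [(abs_le.1 (D.abs_boundary_le _ (hY x hx).1)).2]
  have hS : ∀ x ∈ Icc (a + h β) b, HasDerivWithinAt S (S' x) (Icc (a + h β) b) x := by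
    intro x hx
    have hne : b - a - h (Y x) ≠ 0 := by linarith [hden x hx]
    have h₁ := ((D.hasDerivAt_boundary (Y x)).comp_hasDerivWithinAt x (hY x hx).2).const_sub (b - a)
    have h₂ := (((hasDerivWithinAt_id x (Icc (a + h β) b)).const_sub b).mul_const (b - a))
    refine ((h₂.div h₁ hne).const_sub b).congr_deriv ?_
    simp only [S', g, S, Function.comp_apply, id]
    field_simp
    ring
  have hpos : ∀ x ∈ Icc (a + h β) b, 0 < S' x := by
    intro x hx
    have hd := hden x hx
    have hprod : |(b - x) * (deriv h (Y x) * g x)| ≤ 5 / 4 * (b - a) * (1 / 4 * (1 / 3)) := by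
      have h₁ := D.abs_deriv_boundary_le _ (hY x hx).1
      have h₂ : |g x| ≤ 1 / 3 := D.abs_slope_le _ ⟨clamp_mem_Icc D.lt.le _, (hY x hx).1⟩
      have h₃ : |b - x| ≤ 5 / 4 * (b - a) := by
        rw [abs_of_nonneg] <;> linarith [hx.1, hx.2]
      rw [abs_mul, abs_mul]
      gcongr
    have hp : 0 < b - a - h (Y x) - (b - x) * (deriv h (Y x) * g x) := by
      linarith [(abs_le.1 hprod).2]
    have : 0 < b - a - h (Y x) := by linarith
    positivity
  obtain ⟨hmono, T, hT⟩ := exists_inverse_hasDerivWithinAt hx₀ hS hpos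
  have hSl : S (a + h β) = a := by
    have : b - a - h β ≠ 0 := by linarith
    simp only [S, abscissa, hY₀]
    field_simp
    ring
  have hSr : S b = b := by simp [S, abscissa]
  rw [hSl, hSr] at hT
  have hTa : T a = a + h β := by
    obtain ⟨h₁, h₂, -⟩ := hT a (left_mem_Icc.2 D.lt.le)
    exact hmono.injOn h₁ (left_mem_Icc.2 hx₀) (h₂.trans hSl.symm)
  refine ⟨fun s => Y (T s), by simp only [hTa, hY₀], fun s hs => ?_⟩
  obtain ⟨hTm, hST, hTd⟩ := hT s hs
  obtain ⟨hYm, hYd⟩ := hY _ hTm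
  refine ⟨hYm, (hYd.comp s hTd fun t ht => (hT t ht).1).congr_deriv ?_⟩
  have hg : g (T s) = w (s, Y (T s)) := by
    simp only [g, hST, clamp_eq_self hs]
  have hgd : w (max a (min b (abscissa a b h (T s) (Y (T s)))), Y (T s)) = w (s, Y (T s)) := hg
  have hd := hden _ hTm
  have hne : b - a - h (Y (T s)) ≠ 0 := by linarith
  have hLne : b - a ≠ 0 := hlt.ne'
  have hrel : b - T s = (b - s) * (b - a - h (Y (T s))) / (b - a) := by
    have : b - (b - T s) * (b - a) / (b - a - h (Y (T s))) = s := hST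
    rw [eq_div_iff hLne, ← div_eq_iff hne]
    linarith
  have hdp := (D.denom_pos hs hYm).ne'
  have hS'eq : S' (T s) = ((b - a) - w (s, Y (T s)) * (b - s) * deriv h (Y (T s))) /
      (b - a - h (Y (T s))) := by
    simp only [S', hg, hrel]
    field_simp
  rw [hgd, hS'eq, slopeField, inv_div, mul_div_assoc]

end SmallSlope

/-- the characteristic ODE
`dy₂/ds = v̂₂(s,y₂)(L1 - v̂₄(y₂) - Ls) /
  ((ū(s) + v̂₁(s,y₂))(L1 - Ls) + v̂₂(s,y₂)(s - L1)v̂₄'(y₂))`, `y₂(Ls) = β`,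
on `[Ls, L1]`:  if `ū ≥ c₀ > 0` and the perturbations `v̂₁, v̂₂, v̂₄` are `C¹`
with norms at most a sufficiently small `δ`, and `v̂₂(·, ±1) = 0`, then for
each `β ∈ [-1, 1]` a unique solution exists on all of `[Ls, L1]`, stays in
`[-1, 1]`, and the characteristics through `β = ±1` are the constant lines
`y₂ ≡ ±1` (the boundary is invariant). -/
theorem stmt19 (Ls L1 c0 : ℝ) (hL : Ls < L1) (hc0 : 0 < c0)
    (ub : ℝ → ℝ) (hub : ContDiff ℝ (⊤ : ℕ∞) ub) (hlb : ∀ s ∈ Icc Ls L1, c0 ≤ ub s) :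
    ∃ δ : ℝ, 0 < δ ∧
      ∀ v1 v2 : ℝ × ℝ → ℝ, ∀ v4 : ℝ → ℝ,
        ContDiff ℝ 1 v1 → ContDiff ℝ 1 v2 → ContDiff ℝ 1 v4 →
        (∀ y ∈ Icc Ls L1 ×ˢ Icc (-1 : ℝ) 1, |v1 y| ≤ δ ∧ |v2 y| ≤ δ) →
        (∀ t ∈ Icc (-1 : ℝ) 1, |v4 t| ≤ δ ∧ |deriv v4 t| ≤ δ) →
        (∀ s : ℝ, v2 (s, 1) = 0 ∧ v2 (s, -1) = 0) →
        -- the right-hand side of the characteristic ODE: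
        let F : ℝ → ℝ → ℝ := fun s z =>
          v2 (s, z) * (L1 - v4 z - Ls) /
            ((ub s + v1 (s, z)) * (L1 - Ls) + v2 (s, z) * (s - L1) * deriv v4 z)
        (∀ β ∈ Icc (-1 : ℝ) 1,
          ∃ y : ℝ → ℝ,
            (∀ s ∈ Icc Ls L1, HasDerivWithinAt y (F s (y s)) (Icc Ls L1) s) ∧
            y Ls = β ∧ (∀ s ∈ Icc Ls L1, y s ∈ Icc (-1 : ℝ) 1) ∧
            ∀ z : ℝ → ℝ,
              (∀ s ∈ Icc Ls L1, HasDerivWithinAt z (F s (z s)) (Icc Ls L1) s) →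
              z Ls = β → (∀ s ∈ Icc Ls L1, z s ∈ Icc (-1 : ℝ) 1) →
              EqOn y z (Icc Ls L1)) ∧
        (∀ y : ℝ → ℝ,
          (∀ s ∈ Icc Ls L1, HasDerivWithinAt y (F s (y s)) (Icc Ls L1) s) →
          (∀ s ∈ Icc Ls L1, y s ∈ Icc (-1 : ℝ) 1) →
          (y Ls = 1 → EqOn y (fun _ => 1) (Icc Ls L1)) ∧
          (y Ls = -1 → EqOn y (fun _ => -1) (Icc Ls L1))) := by
  have hL' := sub_pos.2 hL
  refine ⟨min (c0 / 4) (min ((L1 - Ls) / 4) (1 / 4)), by positivity, ?_⟩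
  set δ := min (c0 / 4) (min ((L1 - Ls) / 4) (1 / 4))
  have hδc : δ ≤ c0 / 4 := min_le_left _ _
  have hδL : δ ≤ (L1 - Ls) / 4 := (min_le_right _ _).trans (min_le_left _ _)
  have hδ1 : δ ≤ 1 / 4 := (min_le_right _ _).trans (min_le_right _ _)
  intro v1 v2 v4 hv1 hv2 hv4 hv hv4b hv2z F
  have hub1 : ContDiff ℝ 1 ub := hub.of_le (by exact_mod_cast le_top)
  have hden : ∀ p ∈ Icc Ls L1 ×ˢ Icc (-1 : ℝ) 1, 3 / 4 * c0 ≤ ub p.1 + v1 p := by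
    intro p hp
    linarith [hlb p.1 hp.1, (abs_le.1 (hv p hp).1).1]
  have D : SmallSlope Ls L1 (fun p => v2 p / (ub p.1 + v1 p)) v4 := by
    refine ⟨hL, fun p hp => ?_, fun p hp => ?_, hv4, fun t ht => (hv4b t ht).1.trans hδL,
      fun t ht => (hv4b t ht).2.trans hδ1, fun s _ => ?_, fun s _ => ?_⟩
    · have hne : ub p.1 + v1 p ≠ 0 := by linarith [hden p hp]
      exact hv2.contDiffAt.div ((hub1.comp contDiff_fst).add hv1).contDiffAt hne
    · have hpos : 0 < ub p.1 + v1 p := by linarith [hden p hp]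
      rw [abs_div, abs_of_pos hpos, div_le_iff₀ hpos]
      linarith [(hv p hp).2, hden p hp]
    · simp [(hv2z s).1]
    · simp [(hv2z s).2]
  have hF : ∀ s ∈ Icc Ls L1, ∀ z ∈ Icc (-1 : ℝ) 1,
      F s z = slopeField Ls L1 (fun p => v2 p / (ub p.1 + v1 p)) v4 s z := by
    intro s hs z hz
    have hne : ub s + v1 (s, z) ≠ 0 := by linarith [hden (s, z) ⟨hs, hz⟩]
    have e₁ : (ub s + v1 (s, z)) * (L1 - Ls) + v2 (s, z) * (s - L1) * deriv v4 z =
        (ub s + v1 (s, z)) * ((L1 - Ls) -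
          v2 (s, z) / (ub s + v1 (s, z)) * (L1 - s) * deriv v4 z) := by
      field_simp
      ring
    have e₂ : v2 (s, z) * (L1 - v4 z - Ls) =
        (ub s + v1 (s, z)) * (v2 (s, z) / (ub s + v1 (s, z)) * (L1 - Ls - v4 z)) := by
      field_simp
      ring
    simp only [F, slopeField]
    rw [e₁, e₂, mul_div_mul_left _ _ hne]
  have huniq : ∀ y z : ℝ → ℝ,
      (∀ s ∈ Icc Ls L1, HasDerivWithinAt y (F s (y s)) (Icc Ls L1) s) →
      (∀ s ∈ Icc Ls L1, HasDerivWithinAt z (F s (z s)) (Icc Ls L1) s) →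
      (∀ s ∈ Icc Ls L1, y s ∈ Icc (-1 : ℝ) 1) → (∀ s ∈ Icc Ls L1, z s ∈ Icc (-1 : ℝ) 1) →
      y Ls = z Ls → EqOn y z (Icc Ls L1) := fun y z hy hz hym hzm h0 =>
    D.eqOn_of_solution (fun s hs => hF s hs _ (hym s hs) ▸ hy s hs)
      (fun s hs => hF s hs _ (hzm s hs) ▸ hz s hs) hym hzm h0
  refine ⟨fun β hβ => ?_, fun y hy hym => ⟨fun h1 => ?_, fun h1 => ?_⟩⟩
  · obtain ⟨y, hy0, hy⟩ := D.exists_solution hβ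
    have hyF : ∀ s ∈ Icc Ls L1, HasDerivWithinAt y (F s (y s)) (Icc Ls L1) s :=
      fun s hs => (hF s hs _ (hy s hs).1).symm ▸ (hy s hs).2
    exact ⟨y, hyF, hy0, fun s hs => (hy s hs).1, fun z hz hz0 hzm =>
      huniq y z hyF hz (fun s hs => (hy s hs).1) hzm (hy0.trans hz0.symm)⟩
  · refine huniq y _ hy (fun s _ => ?_) hym (fun _ _ => by norm_num) h1
    simpa [F, (hv2z s).1] using hasDerivWithinAt_const s (Icc Ls L1) (1 : ℝ)
  · refine huniq y _ hy (fun s _ => ?_) hym (fun _ _ => by norm_num) h1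
    simpa [F, (hv2z s).2] using hasDerivWithinAt_const s (Icc Ls L1) (-1 : ℝ)
end
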